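/- Fix n ≥ 1 and p₀ > 0. There exist constants ε₀ > 0 and C₀ > 0 depending only on n and p₀ such that the following holds: let u : ℝⁿ → ℝ be a measurable function bounded on Q_3, and suppose there are 0 ≤ ε ≤ ε₀ and K > 0 such that for every x₀ ∈ ℝⁿ and r > 0 with Q_{6r}(x₀) ⊆ Q_3 one has r^{n/p₀} · ‖u‖_{L^∞(Q_r(x₀))} ≤ ε · r^{n/p₀} · ‖u‖_{L^∞(Q_{3r}(x₀))} + K · ‖u‖_{L^{p₀}(Q_{3r}(x₀))}. Then ‖u‖_{L^∞(Q_1)} ≤ C₀ · K · ‖u‖_{L^{p₀}(Q_3)}. -/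

import Mathlib

open MeasureTheory

noncomputable section

/-- `cube n x₀ r` is the open cube in `ℝⁿ` with center `x₀` and side-length `r`. -/
def cube (n : ℕ) (x₀ : Fin n → ℝ) (r : ℝ) : Set (Fin n → ℝ) :=
  {x | ∀ i, |x i - x₀ i| < r / 2}

/-- The gradient of `u : ℝⁿ → ℝ` at `x`. -/
def grad (n : ℕ) (u : (Fin n → ℝ) → ℝ) (x : Fin n → ℝ) : Fin n → ℝ :=
  fun i => fderiv ℝ u x (Pi.single i 1)

/-- The bilinear form `⟨a(x) ξ, η⟩ = ∑ᵢⱼ aᵢⱼ(x) ξⱼ ηᵢ`. -/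
def aForm (n : ℕ) (a : (Fin n → ℝ) → Matrix (Fin n) (Fin n) ℝ)
    (x : Fin n → ℝ) (ξ η : Fin n → ℝ) : ℝ :=
  ∑ i, ∑ j, a x i j * ξ j * η i

/-- `a` is measurable and uniformly elliptic with ellipticity constants `lam ≤ Lam`:
`lam |ξ|² ≤ ⟨a(x)ξ, ξ⟩ ≤ Lam |ξ|²` for all `x, ξ`. -/
def IsUniformlyElliptic (n : ℕ) (a : (Fin n → ℝ) → Matrix (Fin n) (Fin n) ℝ)
    (lam Lam : ℝ) : Prop :=
  (∀ i j, Measurable fun x => a x i j) ∧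
  ∀ (x ξ : Fin n → ℝ),
    lam * ∑ i, ξ i ^ 2 ≤ aForm n a x ξ ξ ∧ aForm n a x ξ ξ ≤ Lam * ∑ i, ξ i ^ 2

/-- `u` is a weak subsolution of `(aⁱʲ uᵢ)ⱼ = 0` in `Q`: it is differentiable, its gradient is
square-integrable on `Q`, and `∫_Q ⟨a ∇u, ∇φ⟩ ≤ 0` for every nonnegative smooth compactly
supported `φ` with support in `Q`. -/
def IsWeakSubsolution (n : ℕ) (a : (Fin n → ℝ) → Matrix (Fin n) (Fin n) ℝ)
    (u : (Fin n → ℝ) → ℝ) (Q : Set (Fin n → ℝ)) : Prop :=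
  Differentiable ℝ u ∧
  IntegrableOn (fun x => ∑ i, grad n u x i ^ 2) Q volume ∧
  ∀ φ : (Fin n → ℝ) → ℝ, ContDiff ℝ (⊤ : ℕ∞) φ → HasCompactSupport φ → tsupport φ ⊆ Q →
    (∀ x, 0 ≤ φ x) →
    (∫ x in Q, aForm n a x (grad n u x) (grad n φ x)) ≤ 0

/-- `u` is a weak supersolution of `(aⁱʲ uᵢ)ⱼ = 0` in `Q`. -/
def IsWeakSupersolution (n : ℕ) (a : (Fin n → ℝ) → Matrix (Fin n) (Fin n) ℝ)
    (u : (Fin n → ℝ) → ℝ) (Q : Set (Fin n → ℝ)) : Prop :=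
  Differentiable ℝ u ∧
  IntegrableOn (fun x => ∑ i, grad n u x i ^ 2) Q volume ∧
  ∀ φ : (Fin n → ℝ) → ℝ, ContDiff ℝ (⊤ : ℕ∞) φ → HasCompactSupport φ → tsupport φ ⊆ Q →
    (∀ x, 0 ≤ φ x) →
    0 ≤ (∫ x in Q, aForm n a x (grad n u x) (grad n φ x))

/-- `u` is a weak solution of `(aⁱʲ uᵢ)ⱼ = 0` in `Q`. -/
def IsWeakSolution (n : ℕ) (a : (Fin n → ℝ) → Matrix (Fin n) (Fin n) ℝ)
    (u : (Fin n → ℝ) → ℝ) (Q : Set (Fin n → ℝ)) : Prop :=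
  Differentiable ℝ u ∧
  IntegrableOn (fun x => ∑ i, grad n u x i ^ 2) Q volume ∧
  ∀ φ : (Fin n → ℝ) → ℝ, ContDiff ℝ (⊤ : ℕ∞) φ → HasCompactSupport φ → tsupport φ ⊆ Q →
    (∀ x, 0 ≤ φ x) →
    (∫ x in Q, aForm n a x (grad n u x) (grad n φ x)) = 0

/-- The `L^∞` norm (essential supremum of `|u|`) of `u` on `E`. -/
def linftyNorm (n : ℕ) (u : (Fin n → ℝ) → ℝ) (E : Set (Fin n → ℝ)) : ℝ :=
  essSup (fun x => |u x|) (volume.restrict E)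

/-- The `L^q` norm `(∫_E |u|^q)^(1/q)` of `u` on `E`, for `0 < q < ∞`. -/
def lpNorm (n : ℕ) (q : ℝ) (u : (Fin n → ℝ) → ℝ) (E : Set (Fin n → ℝ)) : ℝ :=
  (∫ x in E, |u x| ^ q) ^ (1 / q)

lemma cube_eq_ball (n : ℕ) (x₀ : Fin n → ℝ) (r : ℝ) (hr : 0 < r) :
    cube n x₀ r = Metric.ball x₀ (r / 2) := by
  ext x
  simp only [cube, Set.mem_ofPred_eq, mem_ball_iff_norm]
  rw [pi_norm_lt_iff (by positivity)]
  rfl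

lemma neBot_ball (n : ℕ) (x₀ : Fin n → ℝ) (r : ℝ) (hr : 0 < r) :
    (ae ((volume : Measure (Fin n → ℝ)).restrict (Metric.ball x₀ r))).NeBot := by
  rw [ae_neBot]
  intro h
  rw [Measure.restrict_eq_zero] at h
  exact (Metric.measure_ball_pos volume x₀ hr).ne' h

lemma linfty_le (n : ℕ) (u : (Fin n → ℝ) → ℝ) (x₀ : Fin n → ℝ) (r c : ℝ) (hr : 0 < r)
    (h : ∀ᵐ x ∂(volume : Measure (Fin n → ℝ)), x ∈ Metric.ball x₀ r → |u x| ≤ c) :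
    linftyNorm n u (Metric.ball x₀ r) ≤ c := by
  have := neBot_ball n x₀ r hr
  have h' := (ae_restrict_iff' (μ := volume) (p := fun x => |u x| ≤ c)
    (measurableSet_ball (x := x₀) (ε := r))).2 h
  unfold linftyNorm essSup
  refine Filter.limsup_le_of_le ?_ h'
  refine Filter.IsBoundedUnder.isCoboundedUnder_le ?_
  exact Filter.isBoundedUnder_of ⟨0, fun x => abs_nonneg _⟩

lemma le_linfty (n : ℕ) (u : (Fin n → ℝ) → ℝ) (x₀ : Fin n → ℝ) (r M : ℝ)
    (h : ∀ x ∈ Metric.ball x₀ r, |u x| ≤ M) :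
    ∀ᵐ x ∂(volume : Measure (Fin n → ℝ)), x ∈ Metric.ball x₀ r →
      |u x| ≤ linftyNorm n u (Metric.ball x₀ r) := by
  refine (ae_restrict_iff' (measurableSet_ball (x := x₀) (ε := r))).1 ?_
  refine ae_le_essSup ?_
  refine ⟨M, ?_⟩
  rw [Filter.eventually_map]
  exact ae_restrict_of_forall_mem measurableSet_ball h

lemma lp_mono (n : ℕ) (p : ℝ) (hp : 0 < p) (u : (Fin n → ℝ) → ℝ) (hu : Measurable u)
    (x₀ y : Fin n → ℝ) (r s M : ℝ) (hs : Metric.ball y s ⊆ Metric.ball x₀ r)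
    (h : ∀ x ∈ Metric.ball x₀ r, |u x| ≤ M) :
    lpNorm n p u (Metric.ball y s) ≤ lpNorm n p u (Metric.ball x₀ r) := by
  unfold _root_.lpNorm
  refine Real.rpow_le_rpow (integral_nonneg fun x => by positivity) ?_ (by positivity)
  refine setIntegral_mono_set ?_ (Filter.Eventually.of_forall fun x => by positivity)
    (HasSubset.Subset.eventuallyLE hs)
  refine Measure.integrableOn_of_bounded (M := M ^ p) measure_ball_lt_top.ne ?_ ?_
  · have : Measurable fun x => |u x| ^ p := by
      have := hu.norm
      simp only [Real.norm_eq_abs] at this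
      exact this.pow_const p
    exact this.aestronglyMeasurable
  · refine ae_restrict_of_forall_mem measurableSet_ball fun x hx => ?_
    rw [Real.norm_of_nonneg (by positivity)]
    exact Real.rpow_le_rpow (abs_nonneg _) (h x hx) hp.le

lemma absorb_step (n : ℕ) (p₀ : ℝ) (hp₀ : 0 < p₀) (γ : ℝ) (hγ : 0 ≤ γ)
    (u : (Fin n → ℝ) → ℝ) (hu : Measurable u) (M : ℝ)
    (hM : ∀ x ∈ Metric.ball (0 : Fin n → ℝ) (3 / 2), |u x| ≤ M)
    (ε K : ℝ) (hε : 0 ≤ ε) (hε' : ε ≤ 1 / (2 * 2 ^ γ * 2 ^ γ)) (hK : 0 < K)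
    (H : ∀ (x₀ : Fin n → ℝ) (r : ℝ), 0 < r → cube n x₀ (6 * r) ⊆ cube n 0 3 →
          r ^ γ * linftyNorm n u (cube n x₀ r) ≤
            ε * r ^ γ * linftyNorm n u (cube n x₀ (3 * r)) +
              K * lpNorm n p₀ u (cube n x₀ (3 * r)))
    (A : ℝ) (hA : 0 ≤ A)
    (hA' : ∀ᵐ x ∂(volume : Measure (Fin n → ℝ)), x ∈ Metric.ball (0 : Fin n → ℝ) (3 / 2) →
      (3 / 2 - ‖x‖) ^ γ * |u x| ≤ A) :
    ∀ᵐ x ∂(volume : Measure (Fin n → ℝ)), x ∈ Metric.ball (0 : Fin n → ℝ) (3 / 2) →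
      (3 / 2 - ‖x‖) ^ γ * |u x| ≤
        A / 2 + 2 ^ γ * 3 ^ γ * K * lpNorm n p₀ u (Metric.ball 0 (3 / 2)) := by
  set L := lpNorm n p₀ u (Metric.ball 0 (3 / 2)) with hL
  rw [ae_iff]
  refine measure_null_of_locally_null _ fun x₀ hx₀ => ?_
  have hx₀' : x₀ ∈ Metric.ball (0 : Fin n → ℝ) (3 / 2) := by
    by_contra h; exact hx₀ fun h' => absurd h' h
  rw [mem_ball_zero_iff] at hx₀'
  obtain ⟨d, hd⟩ : ∃ d, d = 3 / 2 - ‖x₀‖ := ⟨_, rfl⟩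
  have hd0 : 0 < d := by linarith
  refine ⟨_, Filter.inter_mem (mem_nhdsWithin_of_mem_nhds
    (Metric.ball_mem_nhds x₀ (show 0 < d / 3 / 2 by positivity))) self_mem_nhdsWithin, ?_⟩
  have key := H x₀ (d / 3) (by positivity) (by
    rw [cube_eq_ball _ _ _ (by positivity), cube_eq_ball _ _ _ (by norm_num)]
    refine Metric.ball_subset_ball' ?_
    rw [dist_zero_right]; linarith)
  rw [cube_eq_ball _ _ _ (by positivity), cube_eq_ball _ _ _ (by positivity),
    show 3 * (d / 3) / 2 = d / 2 by ring] at key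
  have hsub : Metric.ball x₀ (d / 2) ⊆ Metric.ball 0 (3 / 2) := by
    refine Metric.ball_subset_ball' ?_
    rw [dist_zero_right]; linarith
  have hsub' : Metric.ball x₀ (d / 3 / 2) ⊆ Metric.ball x₀ (d / 2) :=
    Metric.ball_subset_ball (by linarith)
  have hdg : 0 < d ^ γ := by positivity
  have h2g : (0 : ℝ) < 2 ^ γ := by positivity
  have h3g : (0 : ℝ) < 3 ^ γ := by positivity
  have hN3 : linftyNorm n u (Metric.ball x₀ (d / 2)) ≤ A / (d ^ γ / 2 ^ γ) := by
    refine linfty_le n u x₀ _ _ (by positivity) ?_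
    filter_upwards [hA'] with x hx hxb
    have h1 := hx (hsub hxb)
    rw [mem_ball_iff_norm] at hxb
    have h2 : ‖x‖ ≤ ‖x - x₀‖ + ‖x₀‖ := by simpa using norm_add_le (x - x₀) x₀
    rw [← Real.div_rpow hd0.le (by norm_num), le_div_iff₀ (by positivity), mul_comm]
    refine le_trans ?_ h1
    gcongr
    linarith
  have hLp : lpNorm n p₀ u (Metric.ball x₀ (d / 2)) ≤ L := lp_mono n p₀ hp₀ u hu _ _ _ _ M hsub hM
  have hN1 := le_linfty n u x₀ (d / 3 / 2) M fun x hx => hM x (hsub (hsub' hx))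
  set N1 := linftyNorm n u (Metric.ball x₀ (d / 3 / 2))
  have hfin : d ^ γ * N1 ≤ ε * 2 ^ γ * A + 3 ^ γ * K * L := by
    rw [Real.div_rpow hd0.le (by norm_num)] at key
    have h4 : d ^ γ / 3 ^ γ * N1 ≤ ε * (d ^ γ / 3 ^ γ) * (A / (d ^ γ / 2 ^ γ)) + K * L := by
      refine key.trans ?_
      gcongr
    have h5 := mul_le_mul_of_nonneg_left h4 h3g.le
    have e1 : 3 ^ γ * (d ^ γ / 3 ^ γ * N1) = d ^ γ * N1 := by field_simp
    have e2 : 3 ^ γ * (ε * (d ^ γ / 3 ^ γ) * (A / (d ^ γ / 2 ^ γ)) + K * L)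
      = ε * 2 ^ γ * A + 3 ^ γ * K * L := by field_simp
    rwa [e1, e2] at h5
  refine measure_mono_null ?_ (ae_iff.1 hN1)
  rintro x ⟨hxb, hxs⟩ hcon
  apply hxs
  intro _
  have h1 := hcon hxb
  rw [mem_ball_iff_norm] at hxb
  have h2 : ‖x₀‖ ≤ ‖x - x₀‖ + ‖x‖ := by
    have := norm_sub_norm_le x₀ x
    rw [norm_sub_rev] at this; linarith
  have h6 : ‖x‖ < 3 / 2 := by
    rename_i h; simpa using h
  calc (3 / 2 - ‖x‖) ^ γ * |u x| ≤ (2 * d) ^ γ * N1 := by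
        gcongr
        linarith
    _ = 2 ^ γ * (d ^ γ * N1) := by rw [Real.mul_rpow (by norm_num) hd0.le]; ring
    _ ≤ 2 ^ γ * (ε * 2 ^ γ * A + 3 ^ γ * K * L) := by gcongr
    _ ≤ 2 ^ γ * ((1 / (2 * 2 ^ γ * 2 ^ γ)) * 2 ^ γ * A + 3 ^ γ * K * L) := by gcongr
    _ = _ := by field_simp

/-- **Absorption lemma** (the iteration hidden in the proof of Lemma 2.1).
Fix `n ≥ 1` and `p₀ > 0`. There are `ε₀ > 0` and `C₀ > 0` depending only on `n, p₀` such that: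
if `u` is measurable, bounded on `Q₃`, and for some `0 ≤ ε ≤ ε₀`, `K > 0` the scaled estimate
`r^{n/p₀} ‖u‖_{L^∞(Q_r(x₀))} ≤ ε r^{n/p₀} ‖u‖_{L^∞(Q_{3r}(x₀))} + K ‖u‖_{L^{p₀}(Q_{3r}(x₀))}`
holds whenever `Q_{6r}(x₀) ⊆ Q₃`, then `‖u‖_{L^∞(Q₁)} ≤ C₀ K ‖u‖_{L^{p₀}(Q₃)}`. -/
theorem absorption_lemma (n : ℕ) (hn : 1 ≤ n) (p₀ : ℝ) (hp₀ : 0 < p₀) :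
    ∃ ε₀ C₀ : ℝ, 0 < ε₀ ∧ 0 < C₀ ∧
      ∀ (u : (Fin n → ℝ) → ℝ), Measurable u →
        (∃ M : ℝ, ∀ x ∈ cube n 0 3, |u x| ≤ M) →
        ∀ (ε K : ℝ), 0 ≤ ε → ε ≤ ε₀ → 0 < K →
        (∀ (x₀ : Fin n → ℝ) (r : ℝ), 0 < r → cube n x₀ (6 * r) ⊆ cube n 0 3 →
          r ^ ((n : ℝ) / p₀) * linftyNorm n u (cube n x₀ r) ≤
            ε * r ^ ((n : ℝ) / p₀) * linftyNorm n u (cube n x₀ (3 * r)) +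
              K * lpNorm n p₀ u (cube n x₀ (3 * r))) →
        linftyNorm n u (cube n 0 1) ≤ C₀ * K * lpNorm n p₀ u (cube n 0 3) := by
  have hγ : 0 ≤ (n : ℝ) / p₀ := by positivity
  set γ := (n : ℝ) / p₀ with hγd
  refine ⟨1 / (2 * 2 ^ γ * 2 ^ γ), 2 * 2 ^ γ * 3 ^ γ, by positivity, by positivity, ?_⟩
  rintro u hu ⟨M, hM⟩ ε K hε hε' hK H
  rw [cube_eq_ball _ _ _ (by norm_num)] at hM
  rw [cube_eq_ball _ _ _ (by norm_num), cube_eq_ball _ _ _ (by norm_num)]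
  set L := lpNorm n p₀ u (Metric.ball 0 (3 / 2)) with hL
  have hL0 : 0 ≤ L := Real.rpow_nonneg (integral_nonneg fun x => by positivity) _
  have hM0 : 0 ≤ M := (abs_nonneg _).trans (hM 0 (by simp))
  set B := 2 ^ γ * 3 ^ γ * K * L with hB
  have hB0 : 0 ≤ B := by positivity
  have hit : ∀ k : ℕ, ∀ᵐ x ∂(volume : Measure (Fin n → ℝ)),
      x ∈ Metric.ball (0 : Fin n → ℝ) (3 / 2) →
      (3 / 2 - ‖x‖) ^ γ * |u x| ≤ (3 / 2) ^ γ * M * (1 / 2) ^ k + 2 * B := by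
    intro k
    induction k with
    | zero =>
      refine Filter.Eventually.of_forall fun x hx => ?_
      have h1 := hM x hx
      rw [mem_ball_zero_iff] at hx
      have : (3 / 2 - ‖x‖) ^ γ * |u x| ≤ (3 / 2) ^ γ * M := by
        gcongr
        linarith [norm_nonneg x]
      rw [pow_zero, mul_one]
      linarith
    | succ k ih =>
      have := absorb_step n p₀ hp₀ γ hγ u hu M hM ε K hε hε' hK H _ (by positivity) ih
      filter_upwards [this] with x hx hxb
      refine (hx hxb).trans (le_of_eq ?_)
      rw [← hL, ← hB, pow_succ]
      ring
  refine linfty_le n u 0 _ _ (by norm_num) ?_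
  filter_upwards [ae_all_iff.2 hit] with x hx hxb
  have hxb' := hxb
  rw [mem_ball_zero_iff] at hxb
  have hx' := fun k => hx k (Metric.ball_subset_ball (by norm_num) hxb')
  have hlim : Filter.Tendsto (fun k : ℕ => (3 / 2) ^ γ * M * (1 / 2 : ℝ) ^ k + 2 * B)
      Filter.atTop (nhds ((3 / 2) ^ γ * M * 0 + 2 * B)) :=
    ((tendsto_pow_atTop_nhds_zero_of_lt_one (by norm_num) (by norm_num)).const_mul _).add_const _
  have h1 := ge_of_tendsto' hlim hx'
  have h2 : 1 ≤ (3 / 2 - ‖x‖) ^ γ := Real.one_le_rpow (by linarith) hγ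
  have h3 : |u x| ≤ (3 / 2 - ‖x‖) ^ γ * |u x| := le_mul_of_one_le_left (abs_nonneg _) h2
  calc |u x| ≤ 2 * B := by linarith
    _ = _ := by rw [hB]; ring
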